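/- arXiv:2408.02588 — 2 statements merged into one kernel-verified Lean document; each statement's English description precedes it below -/
import Mathlib

section
/- For every ε > 0 there is n₀ such that every 3-uniform hypergraph H on n ≥ n₀ vertices with minimum codegree δ₂(H) ≥ (1/3 + ε)n contains a homomorphic image of the tight cycle C₁₀, i.e., vertices w_1, …, w_{10} (indices mod 10, consecutive triples distinct) with {w_i, w_{i+1}, w_{i+2}} ∈ E(H) for all i. -/
open Finset in
/-- Three sets, each larger than a third of the ground set, are not pairwise disjoint. -/
theorem three_sets {V : Type} [Fintype V] [DecidableEq V] (A B C : Finset V)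
    (hA : Fintype.card V < 3 * A.card) (hB : Fintype.card V < 3 * B.card)
    (hC : Fintype.card V < 3 * C.card) :
    (∃ x, x ∈ A ∧ x ∈ B) ∨ (∃ x, x ∈ A ∧ x ∈ C) ∨ (∃ x, x ∈ B ∧ x ∈ C) := by
  by_contra hcon
  push Not at hcon
  obtain ⟨h1, h2, h3⟩ := hcon
  have d1 : Disjoint A B := Finset.disjoint_left.2 h1
  have d2 : Disjoint (A ∪ B) C := by
    rw [Finset.disjoint_union_left]
    exact ⟨Finset.disjoint_left.2 h2, Finset.disjoint_left.2 h3⟩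
  have h := Finset.card_le_univ ((A ∪ B) ∪ C)
  rw [Finset.card_union_of_disjoint d2, Finset.card_union_of_disjoint d1] at h
  omega

/-- Abstract form: a symmetric ternary relation with large codegrees contains a closed
tight walk of length ten. -/
theorem core {V : Type} [Fintype V] [DecidableEq V] (R : V → V → V → Prop)
    (h1 : ∀ a b c, R a b c → R b a c) (h2 : ∀ a b c, R a b c → R a c b)
    (hne : ∀ a b c, R a b c → a ≠ b)
    (N : V → V → Finset V) (hN : ∀ a b c, c ∈ N a b ↔ R a b c)
    (hbig : ∀ a b, a ≠ b → Fintype.card V < 3 * (N a b).card)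
    (hV : 6 ≤ Fintype.card V)
    (hno : ∀ a b c d e f g h i j, R a b c → R b c d → R c d e → R d e f → R e f g → R f g h →
      R g h i → R h i j → R i j a → R j a b → False) : False := by
  classical
  -- an edge with apex `b`, with witness `x`
  let A : V → V → V → Prop := fun b a c => R b a c ∧ ∃ x, R b a x ∧ R b c x
  have hAs : ∀ b a c, A b a c → A b c a := by
    rintro b a c ⟨h, x, hx, hy⟩
    exact ⟨h2 _ _ _ h, x, hy, hx⟩
  have hapex : ∀ a b c, R a b c → A a b c ∨ A b a c ∨ A c a b := by
    intro a b c h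
    have e1 := hne _ _ _ h
    have e2 := hne _ _ _ (h2 _ _ _ h)
    have e3 := hne _ _ _ (h2 _ _ _ (h1 _ _ _ h))
    rcases three_sets (N a b) (N a c) (N b c) (hbig _ _ e1) (hbig _ _ e2) (hbig _ _ e3) with
      ⟨x, p, q⟩ | ⟨x, p, q⟩ | ⟨x, p, q⟩ <;> rw [hN] at p q
    · exact Or.inl ⟨h, x, p, q⟩
    · exact Or.inr (Or.inl ⟨h1 _ _ _ h, x, h1 _ _ _ p, q⟩)
    · exact Or.inr (Or.inr ⟨h1 _ _ _ (h2 _ _ _ h), x, h1 _ _ _ p, h1 _ _ _ q⟩)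
  have r1 : ∀ {a b c}, R a b c → R b a c := fun h => h1 _ _ _ h
  have r2 : ∀ {a b c}, R a b c → R a c b := fun h => h2 _ _ _ h
  -- two opposite apices on a pair
  have hDD : ∀ u v x y, A u v x → A v u y → False := by
    rintro u v x y ⟨k1, x', k2, k3⟩ ⟨l1, y', l2, l3⟩
    exact hno u v x u x' v u y v y' k1 (r2 (r1 k1)) (r1 k3) (r2 k2)
      (r1 (r2 (r1 k2))) l1 (r2 (r1 l1)) (r1 l3) (r2 l2) (r1 (r2 (r1 l2)))
  have hDU : ∀ u v x y, A u v x → A y u v → False := by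
    rintro u v x y ⟨k1, x', k2, k3⟩ ⟨l1, y', l2, l3⟩
    exact hno v u x x' u v y y' u y (r1 k1) k3 (r2 (r1 k3)) (r1 (r2 k2)) (r2 (r1 l1))
      (r1 l3) (r2 l2) (r1 (r2 (r1 l2))) (r1 l1) (r2 l1)
  have hex : ∀ a b, a ≠ b → ∃ c, R a b c := by
    intro a b h
    have := hbig a b h
    have h0 : 0 < (N a b).card := by omega
    obtain ⟨c, hc⟩ := Finset.card_pos.1 h0
    exact ⟨c, (hN _ _ _).1 hc⟩
  have hD : ∀ b a c w, A b a c → R b a w → A b a w := by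
    intro b a c w h hw
    rcases hapex _ _ _ hw with k | k | k
    · exact k
    · exact (hDD _ _ _ _ h k).elim
    · exact (hDU _ _ _ _ h k).elim
  have hU : ∀ b a c w, A b a c → R a c w → A w a c := by
    intro b a c w h hw
    rcases hapex _ _ _ hw with k | k | k
    · exact (hDU _ _ _ _ k h).elim
    · exact (hDU _ _ _ _ k (hAs _ _ _ h)).elim
    · exact k
  -- a vertex cannot be an apex and a non-apex at once
  have hmix : ∀ b a c d e, A b a c → A d b e → False := by
    intro b a c d e hb hd
    have e1 := hne _ _ _ hb.1
    have e2 := hne _ _ _ (r1 hd.1)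
    have e3 := hne _ _ _ (r2 (r1 hd.1))
    rcases three_sets (N b a) (N b d) (N b e) (hbig _ _ e1) (hbig _ _ e2) (hbig _ _ e3) with
      ⟨x, p, q⟩ | ⟨x, p, q⟩ | ⟨x, p, q⟩ <;> rw [hN] at p q
    -- `b` is an apex over `x`, while `b`, `x` is a non-apex pair under `d`
    · exact hDU _ _ _ _ (hAs _ _ _ (hD _ _ _ _ hb p)) (hD _ _ _ _ hd (r1 q))
    · exact hDD _ _ _ _ (hAs _ _ _ (hD _ _ _ _ hb p)) (hU _ _ _ _ hd q)
    · exact hDU _ _ _ _ (hU _ _ _ _ hd q) (hAs _ _ _ (hD _ _ _ _ hd (r1 p)))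
  have hcon : ∀ b a c b' a' c', A b a c → A b' a' c' → b = b' := by
    intro b a c b' a' c' h h'
    by_contra hbb
    obtain ⟨w, hw⟩ := hex _ _ hbb
    rcases hapex _ _ _ hw with k | k | k
    · exact hmix _ _ _ _ _ h' (k)
    · exact hmix _ _ _ _ _ h k
    · exact hmix _ _ _ _ _ h k
  have hcard : 1 < Fintype.card V := by omega
  obtain ⟨a, b, hab⟩ := Fintype.exists_pair_of_one_lt_card hcard
  obtain ⟨c, hc⟩ := hex _ _ hab
  have : ∃ b a c, A b a c := by
    rcases hapex _ _ _ hc with k | k | k <;> exact ⟨_, _, _, k⟩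
  obtain ⟨b, a, c, h⟩ := this
  have hac : a ≠ c := by
    have := hne _ _ _ (r2 (r1 h.1))
    exact this
  have hb2 := hbig _ _ hac
  have : 1 < (N a c).card := by omega
  obtain ⟨x, hx, y, hy, hxy⟩ := Finset.one_lt_card.1 this
  rw [hN] at hx hy
  exact hxy (hcon _ _ _ _ _ _ (hU _ _ _ _ h hx) (hU _ _ _ _ h hy))

/-- For every `ε > 0` there is `n₀` such that every 3-uniform hypergraph
`H` on `n ≥ n₀` vertices with minimum codegree `δ₂(H) ≥ (1/3 + ε)n` contains a
homomorphic image of the tight cycle `C₁₀`: a map `w : ZMod 10 → V(H)` with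
`{w i, w (i+1), w (i+2)} ∈ E(H)` for all `i` (each such triple being an edge, its
three vertices are distinct). -/
theorem stmt18 (ε : ℝ) (hε : 0 < ε) :
    ∃ n₀ : ℕ, ∀ (V : Type) [Fintype V] [DecidableEq V] (E : Set (Finset V)),
      n₀ ≤ Fintype.card V →
      (∀ e ∈ E, e.card = 3) →
      (∀ u v : V, u ≠ v →
        (1 / 3 + ε) * (Fintype.card V : ℝ) ≤
          (({w | ({u, v, w} : Finset V) ∈ E} : Set V).ncard : ℝ)) →
      ∃ w : ZMod 10 → V, ∀ i : ZMod 10,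
        ({w i, w (i + 1), w (i + 2)} : Finset V) ∈ E := by
  refine ⟨6, ?_⟩
  intro V _ _ E hn h3 hdeg
  classical
  by_contra hcon
  have hcardne : ∀ a b c : V, ({a, b, c} : Finset V) ∈ E → a ≠ b := by
    rintro a b c h rfl
    have h' := h3 _ h
    have : ({a, a, c} : Finset V).card ≤ 2 := by
      rw [Finset.insert_eq_of_mem (Finset.mem_insert_self _ _)]
      exact Finset.card_le_two
    omega
  refine core (fun a b c => ({a, b, c} : Finset V) ∈ E) ?_ ?_ hcardne
    (fun a b => Finset.univ.filter fun c => ({a, b, c} : Finset V) ∈ E) ?_ ?_ hn ?_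
  · intro a b c h
    rwa [Finset.insert_comm] at h
  · intro a b c h
    rwa [Finset.pair_comm b c] at h
  · intro a b c
    simp
  · intro a b hab
    have h := hdeg a b hab
    have hs : ({w | ({a, b, w} : Finset V) ∈ E} : Set V)
        = ((Finset.univ.filter fun c => ({a, b, c} : Finset V) ∈ E : Finset V) : Set V) := by
      ext w
      simp
    rw [hs, Set.ncard_coe_finset] at h
    have hpos : (6 : ℝ) ≤ (Fintype.card V : ℝ) := by exact_mod_cast hn
    have hm : 0 < ε * (Fintype.card V : ℝ) := by positivity
    have : (Fintype.card V : ℝ)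
        < 3 * ((Finset.univ.filter fun c => ({a, b, c} : Finset V) ∈ E).card : ℝ) := by
      linarith
    exact_mod_cast this
  · intro a b c d e f g h i j p0 p1 p2 p3 p4 p5 p6 p7 p8 p9
    apply hcon
    refine ⟨(![a, b, c, d, e, f, g, h, i, j] : Fin 10 → V), ?_⟩
    intro k
    change Fin 10 at k
    fin_cases k
    · exact p0
    · exact p1
    · exact p2
    · exact p3
    · exact p4
    · exact p5
    · exact p6
    · exact p7
    · exact p8
    · exact p9
end

section
/- For ℓ ∈ {10, 13, 16} and every ℓ ≥ 19 not divisible by 3, the codegree Turán density of the tight cycle satisfies γ(C_ℓ) = 1/3. In particular, γ(C_ℓ) ≥ 1/3 follows from the tripartite mod-3 construction, and γ(C_ℓ) ≤ γ(C₁₀) ≤ 1/3 follows via homomorphisms C_{ℓ+3} → C_ℓ and C_{tℓ} → C_ℓ. -/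
open Filter

/-- The edge set of the tight cycle `C_ℓ` on vertex set `ZMod ℓ`:
the triples `{j, j+1, j+2}`. -/
def CycleEdges (ℓ : ℕ) : Set (Finset (ZMod ℓ)) :=
  {e | ∃ j : ZMod ℓ, e = ({j, j + 1, j + 2} : Finset (ZMod ℓ))}

/-- `ex₂(n, F)`: the maximum `d` such that there is an `F`-free 3-uniform hypergraph on
`n` vertices (edge set over `Fin n`, all edges of size 3, containing no injective copy
of `F`) with minimum codegree at least `d`. -/
noncomputable def ex2 {α : Type*} [DecidableEq α] (n : ℕ) (F : Set (Finset α)) : ℕ :=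
  sSup {d | ∃ E : Set (Finset (Fin n)),
    (∀ e ∈ E, e.card = 3) ∧
    (¬ ∃ φ : α → Fin n, Function.Injective φ ∧ ∀ e ∈ F, e.image φ ∈ E) ∧
    (∀ u v : Fin n, u ≠ v →
      d ≤ ({w | ({u, v, w} : Finset (Fin n)) ∈ E} : Set (Fin n)).ncard)}

/-- Tight walks with `L` steps between ordered pairs. -/
def TW {V : Type*} (T : V → V → V → Prop) : ℕ → V → V → V → V → Prop
  | 0, a, b, c, d => a = c ∧ b = d
  | (n + 1), a, b, c, d => ∃ e, T a b e ∧ TW T n b e c d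

theorem TW.append {V : Type*} {T : V → V → V → Prop} {m n : ℕ} {a b c d e f : V}
    (h : TW T m a b c d) (h' : TW T n c d e f) : TW T (m + n) a b e f := by
  induction m generalizing a b with
  | zero => obtain ⟨rfl, rfl⟩ := h; simpa using h'
  | succ k ih =>
    obtain ⟨x, hx, hw⟩ := h
    have e : k + 1 + n = (k + n) + 1 := by omega
    rw [e]
    exact ⟨x, hx, ih hw⟩

theorem TW.seq {V : Type*} {T : V → V → V → Prop} {L : ℕ} {a b c d : V}
    (h : TW T L a b c d) : ∃ s : ℕ → V, s 0 = a ∧ s 1 = b ∧ s L = c ∧ s (L + 1) = d ∧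
      ∀ i < L, T (s i) (s (i + 1)) (s (i + 2)) := by
  induction L generalizing a b with
  | zero =>
    obtain ⟨rfl, rfl⟩ := h
    exact ⟨fun i => if i = 0 then a else b, by simp, by simp, by simp, by simp, by simp⟩
  | succ k ih =>
    obtain ⟨x, hx, hw⟩ := h
    obtain ⟨s, h0, h1, h2, h3, h4⟩ := ih hw
    refine ⟨fun i => Nat.casesOn i a s, rfl, h0, h2, h3, ?_⟩
    intro i hi
    cases i with
    | zero => simpa [h0, h1] using hx
    | succ j => exact h4 j (by omega)

theorem TW.cyc {V : Type*} {T : V → V → V → Prop} {L : ℕ} (hL : 2 ≤ L) {a b : V}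
    (h : TW T L a b a b) : ∃ φ : ZMod L → V, ∀ j, T (φ j) (φ (j + 1)) (φ (j + 2)) := by
  obtain ⟨s, h0, h1, h2, h3, h4⟩ := h.seq
  have : NeZero L := ⟨by omega⟩
  have key : ∀ i ≤ L + 1, s i = s ((i : ZMod L).val) := by
    intro i hi
    rcases Nat.lt_or_ge i L with hlt | hge
    · rw [ZMod.val_cast_of_lt hlt]
    · obtain rfl | rfl : i = L ∨ i = L + 1 := by omega
      · simp [h2, h0]
      · rw [h3, ← h1]
        push_cast
        have : ((1 : ℕ) : ZMod L).val = 1 := ZMod.val_cast_of_lt (by omega)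
        simp at this
        simp [this]
  refine ⟨fun j => s j.val, fun j => ?_⟩
  have hj := ZMod.val_lt j
  have := h4 j.val hj
  rw [key (j.val + 1) (by omega), key (j.val + 2) (by omega)] at this
  simpa using this

/-- Homomorphism version of the main result. -/
theorem walk_ten {V : Type*} [Fintype V] (T : V → V → V → Prop)
    (s1 : ∀ a b c, T a b c → T b a c) (s2 : ∀ a b c, T a b c → T b c a)
    (hne : ∀ a b c, T a b c → a ≠ b) (h3 : 3 ≤ Fintype.card V)
    (hd : ∀ u v, u ≠ v → Fintype.card V < 3 * {w | T u v w}.ncard) :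
    ∃ a b, TW T 10 a b a b ∧ TW T 3 a b a b := by
  classical
  by_contra hcon
  have no10 : ∀ a b, a ≠ b → ¬ TW T 10 a b a b := by
    intro a b hab h
    refine hcon ⟨a, b, h, ?_⟩
    obtain ⟨e, he, -⟩ := h
    exact ⟨e, he, a, s2 _ _ _ he, b, s2 _ _ _ (s2 _ _ _ he), rfl, rfl⟩
  let B : V → V → Prop := fun x y => ∃ z w, T y x z ∧ T y z w ∧ T y x w
  let R : V → V → Prop := fun x z => ∃ y w, T y x z ∧ T y z w ∧ T y x w
  have s3 : ∀ a b c, T a b c → T a c b := fun a b c h => s1 _ _ _ (s2 _ _ _ (s2 _ _ _ h))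
  have s4 : ∀ a b c, T a b c → T c a b := fun a b c h => (s2 _ _ _ (s2 _ _ _ h))
  have s5 : ∀ a b c, T a b c → T c b a := fun a b c h => s1 _ _ _ (s2 _ _ _ h)
  have Bne : ∀ x y, B x y → x ≠ y := by
    rintro x y ⟨z, w, h, -, -⟩; exact (hne _ _ _ h).symm
  have Rne : ∀ x y, R x y → x ≠ y := by
    rintro x z ⟨y, w, h, -, -⟩; exact (hne _ _ _ (s2 _ _ _ h))
  have Rsymm : ∀ x y, R x y → R y x := by
    rintro x z ⟨y, w, h1, h2, h3⟩; exact ⟨y, w, s3 _ _ _ h1, h3, h2⟩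
  have B5 : ∀ x y, B x y → TW T 5 y x x y := by
    rintro x y ⟨z, w, h1, h2, h3⟩
    refine ⟨z, h1, y, s2 _ _ _ h1, w, s1 _ _ _ h2, x, s3 _ _ _ h3, y, s5 _ _ _ h3, rfl, rfl⟩
  have B4 : ∀ x y, B x y → TW T 4 x y y x := by
    rintro x y ⟨z, w, h1, h2, h3⟩
    refine ⟨z, s1 _ _ _ h1, w, h2, y, s2 _ _ _ h2, x, s4 _ _ _ h3, rfl, rfl⟩
  have R6 : ∀ x z, R x z → TW T 6 x z z x := by
    rintro x z ⟨y, w, h1, h2, h3⟩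
    refine ⟨y, s2 _ _ _ h1, x, s4 _ _ _ h1, w, h3, y, s2 _ _ _ h3, z, ?_, x, s3 _ _ _ h1, rfl, rfl⟩
    exact s4 _ _ _ h2
  have BB : ∀ x y, B x y → ¬ B y x := fun x y h h' =>
    no10 y x (Bne _ _ h') ((B5 x y h).append (B5 y x h'))
  have RB : ∀ x y, R x y → ¬ B x y := fun x y h h' =>
    no10 y x (Bne _ _ h').symm ((R6 y x (Rsymm _ _ h)).append (B4 x y h'))
  have RB' : ∀ x y, R x y → ¬ B y x := fun x y h => RB y x (Rsymm _ _ h)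
  have apex : ∀ x y z, T x y z → (R x z ∧ B x y ∧ B z y) ∨ (R x y ∧ B x z ∧ B y z) ∨
      (R y z ∧ B y x ∧ B z x) := by
    intro x y z h
    have main : ∀ x y z w, T x y z → T x y w → T y z w → (R x z ∧ B x y ∧ B z y) := by
      intro x y z w h1 h2 h3
      have a1 := s1 _ _ _ h1
      have a2 := s1 _ _ _ h2
      exact ⟨⟨y, w, a1, h3, a2⟩, ⟨z, w, a1, h3, a2⟩, ⟨x, w, s3 _ _ _ a1, a2, h3⟩⟩
    have c1 := hd x y (hne _ _ _ h)
    have c2 := hd y z (hne _ _ _ (s2 _ _ _ h))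
    have c3 := hd x z (hne _ _ _ (s3 _ _ _ h))
    by_contra hno
    push Not at hno
    have d12 : Disjoint {w | T x y w} {w | T y z w} := by
      rw [Set.disjoint_left]
      intro w hw1 hw2
      have := main x y z w h hw1 hw2
      exact hno.1 this.1 this.2.1 this.2.2
    have d3 : Disjoint ({w | T x y w} ∪ {w | T y z w}) {w | T x z w} := by
      rw [Set.disjoint_left]
      rintro w (hw1 | hw2) hw3
      · have := main y x z w (s1 _ _ _ h) (s1 _ _ _ hw1) hw3
        exact hno.2.2 this.1 this.2.1 this.2.2
      · have := main x z y w (s3 _ _ _ h) hw3 (s1 _ _ _ hw2)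
        exact hno.2.1 this.1 this.2.1 this.2.2
    have e1 := Set.ncard_union_eq d12
    have e2 := Set.ncard_union_eq d3
    have e3 := Set.ncard_le_card (({w | T x y w} ∪ {w | T y z w}) ∪ {w | T x z w})
    rw [Nat.card_eq_fintype_card] at e3
    omega
  have ex : ∀ u v, u ≠ v → ∃ w, T u v w := by
    intro u v huv
    have := hd u v huv
    by_contra hno
    push Not at hno
    simp [hno] at this
  have bred : ∀ x y, B x y → Fintype.card V < 3 * {z | R x z}.ncard := by
    intro x y h
    refine lt_of_lt_of_le (hd x y (Bne _ _ h)) (Nat.mul_le_mul_left _ (Set.ncard_le_ncard ?_))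
    intro z hz
    rcases apex x y z hz with h1 | h1 | h1
    · exact h1.1
    · exact absurd h (RB _ _ h1.1)
    · exact absurd h1.2.1 (BB _ _ h)
  have bin : ∀ x y, B x y → Fintype.card V < 3 * {z | B z y}.ncard := by
    intro x y h
    refine lt_of_lt_of_le (hd x y (Bne _ _ h)) (Nat.mul_le_mul_left _ (Set.ncard_le_ncard ?_))
    intro z hz
    rcases apex x y z hz with h1 | h1 | h1
    · exact h1.2.2
    · exact absurd h (RB _ _ h1.1)
    · exact absurd h1.2.1 (BB _ _ h)
  have rN : ∀ x z y, R x z → T x z y → B x y := by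
    intro x z y h hy
    rcases apex x z y hy with h1 | h1 | h1
    · exact absurd h1.2.1 (RB _ _ h)
    · exact h1.2.1
    · exact absurd h1.2.1 (RB' _ _ h)
  have rout : ∀ x z, R x z → Fintype.card V < 3 * {y | B x y}.ncard := by
    intro x z h
    exact lt_of_lt_of_le (hd x z (Rne _ _ h)) (Nat.mul_le_mul_left _ (Set.ncard_le_ncard
      (fun y hy => rN x z y h hy)))
  have sumle : ∀ y, {z | B z y}.ncard + {z | B y z}.ncard + {z | R y z}.ncard ≤ Fintype.card V := by
    intro y
    have d12 : Disjoint {z | B z y} {z | B y z} := by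
      rw [Set.disjoint_left]
      exact fun z h h' => BB _ _ h h'
    have d3 : Disjoint ({z | B z y} ∪ {z | B y z}) {z | R y z} := by
      rw [Set.disjoint_left]
      rintro z (h | h) h'
      · exact RB' _ _ h' h
      · exact RB _ _ h' h
    have e1 := Set.ncard_union_eq d12
    have e2 := Set.ncard_union_eq d3
    have e3 := Set.ncard_le_card (({z | B z y} ∪ {z | B y z}) ∪ {z | R y z})
    rw [Nat.card_eq_fintype_card] at e3
    omega
  have noR : ∀ x y, B x y → ∀ z, ¬ R y z := by
    intro x y h z hz
    have k1 := bin _ _ h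
    have k2 := rout _ _ hz
    have k3 : {u | B y u}.Nonempty := by
      rw [← Set.ncard_pos]; omega
    obtain ⟨u, hu⟩ := k3
    have k4 := bred _ _ hu
    have := sumle y
    omega
  have noB : ∀ x y, B x y → ∀ z, ¬ B y z := by
    intro x y h z hz
    have k4 := bred _ _ hz
    have k3 : {u | R y u}.Nonempty := by
      rw [← Set.ncard_pos]; omega
    obtain ⟨u, hu⟩ := k3
    exact noR x y h u hu
  -- a red pair exists
  have hred : ∃ x z, R x z := by
    obtain ⟨a, b, hab⟩ := Fintype.exists_pair_of_one_lt_card (α := V) (by omega)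
    obtain ⟨c, hc⟩ := ex a b hab
    rcases apex a b c hc with h | h | h
    · exact ⟨_, _, h.1⟩
    · exact ⟨_, _, h.1⟩
    · exact ⟨_, _, h.1⟩
  obtain ⟨x, z, hxz⟩ := hred
  have h2 : 1 < {w | T x z w}.ncard := by
    have := hd x z (Rne _ _ hxz)
    omega
  rw [Set.one_lt_ncard] at h2
  obtain ⟨y, hy, y', hy', hyy⟩ := h2
  have by1 := rN _ _ _ hxz hy
  have by2 := rN _ _ _ hxz hy'
  obtain ⟨w, hw⟩ := ex y y' hyy
  rcases apex _ _ _ hw with h | h | h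
  · exact noB _ _ by1 _ h.2.1
  · exact noR _ _ by1 _ h.1
  · exact noB _ _ by2 _ h.2.1

theorem cyc_hom {V : Type*} [Fintype V] (T : V → V → V → Prop)
    (s1 : ∀ a b c, T a b c → T b a c) (s2 : ∀ a b c, T a b c → T b c a)
    (hne : ∀ a b c, T a b c → a ≠ b) (h3 : 3 ≤ Fintype.card V)
    (hd : ∀ u v, u ≠ v → Fintype.card V < 3 * {w | T u v w}.ncard)
    (ℓ : ℕ) (hℓ : ℓ = 10 ∨ ℓ = 13 ∨ ℓ = 16 ∨ (19 ≤ ℓ ∧ ¬ 3 ∣ ℓ)) :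
    ∃ φ : ZMod ℓ → V, ∀ j, T (φ j) (φ (j + 1)) (φ (j + 2)) := by
  obtain ⟨a, b, h10, h3⟩ := walk_ten T s1 s2 hne h3 hd
  have hadd : ∀ k n, TW T n a b a b → TW T (n + 3 * k) a b a b := by
    intro k
    induction k with
    | zero => intro n h; simpa using h
    | succ k ih => intro n h; exact (ih n h).append h3
  have h : (∃ k, ℓ = 10 + 3 * k) ∨ ∃ k, ℓ = 20 + 3 * k := by
    by_cases h : ℓ % 3 = 1
    · left; exact ⟨(ℓ - 10) / 3, by omega⟩
    · right; exact ⟨(ℓ - 20) / 3, by omega⟩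
  apply TW.cyc (by omega : 2 ≤ ℓ) (a := a) (b := b)
  rcases h with ⟨k, rfl⟩ | ⟨k, rfl⟩
  · exact hadd k _ h10
  · exact hadd k _ (h10.append h10)

theorem blow_one {V B : Type*} [Fintype V] [Fintype B] (P : V → B → Prop) (c : ℝ) (hc : 0 ≤ c)
    (t : ℕ) (h : c * (Fintype.card V * Fintype.card B) ≤ Nat.card {p : V × B // P p.1 p.2}) :
    c ^ (t + 1) * ((Fintype.card V : ℝ) ^ (t + 1) * Fintype.card B) ≤
      Nat.card {p : (Fin (t + 1) → V) × B // ∀ i, P (p.1 i) p.2} := by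
  classical
  have e1 : Nat.card {p : V × B // P p.1 p.2} = ∑ b : B, Nat.card {v // P v b} := by
    rw [← Nat.card_sigma]
    exact Nat.card_congr ⟨fun p => ⟨p.1.2, p.1.1, p.2⟩, fun p => ⟨(p.2.1, p.1), p.2.2⟩,
      fun p => rfl, fun p => rfl⟩
  have e2 : Nat.card {p : (Fin (t + 1) → V) × B // ∀ i, P (p.1 i) p.2} =
      ∑ b : B, Nat.card {v // P v b} ^ (t + 1) := by
    have : ∀ b : B, Nat.card {v // P v b} ^ (t + 1) = Nat.card (Fin (t + 1) → {v // P v b}) := by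
      intro b; rw [Nat.card_pi]; simp
    simp_rw [this]
    rw [← Nat.card_sigma]
    exact Nat.card_congr ⟨fun p => ⟨p.1.2, fun i => ⟨p.1.1 i, p.2 i⟩⟩,
      fun p => ⟨(fun i => (p.2 i).1, p.1), fun i => (p.2 i).2⟩,
      fun p => rfl, fun p => rfl⟩
  rw [e1] at h
  rw [e2]
  push_cast at h ⊢
  rcases isEmpty_or_nonempty B with hB | hB
  · simp
  have hb : (0 : ℝ) < Fintype.card B := by exact_mod_cast Fintype.card_pos
  refine le_trans ?_ (pow_sum_div_card_le_sum_pow (s := Finset.univ)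
    (f := fun b : B => (Nat.card {v // P v b} : ℝ)) (fun _ _ => by positivity) t)
  rw [le_div_iff₀ (by simpa using pow_pos hb t)]
  refine le_trans (le_of_eq ?_) (pow_le_pow_left₀ (by positivity) h (t + 1))
  simp only [Finset.card_univ]
  ring

theorem blow_up {V : Type} [Fintype V] (t m : ℕ) : ∀ {B : Type} [Fintype B]
    (P : (Fin m → V) → B → Prop) (c : ℝ) (_ : 0 ≤ c)
    (_ : c * ((Fintype.card V : ℝ) ^ m * Fintype.card B) ≤
      Nat.card {p : (Fin m → V) × B // P p.1 p.2}),
    c ^ ((t + 1) ^ m) * ((Fintype.card V : ℝ) ^ ((t + 1) * m) * Fintype.card B) ≤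
      Nat.card {p : (Fin m → Fin (t + 1) → V) × B //
        ∀ d : Fin m → Fin (t + 1), P (fun i => p.1 i (d i)) p.2} := by
  classical
  induction m with
  | zero =>
    intro B _ P c hc h
    simp only [pow_zero, mul_zero, pow_one] at h ⊢
    refine h.trans (le_of_eq ?_)
    congr 1
    apply Nat.card_congr
    refine ⟨fun p => ⟨(fun i => i.elim0, p.1.2), fun d => ?_⟩,
      fun p => ⟨(fun i => i.elim0, p.1.2), ?_⟩, ?_, ?_⟩
    · convert p.2
    · convert p.2 (fun i => i.elim0)
    · rintro ⟨⟨a, b⟩, h⟩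
      simp only [Subtype.mk.injEq, Prod.mk.injEq, and_true]
      exact Subsingleton.elim _ _
    · rintro ⟨⟨a, b⟩, h⟩
      simp only [Subtype.mk.injEq, Prod.mk.injEq, and_true]
      exact Subsingleton.elim _ _
  | succ m ih =>
    intro B _ P c hc h
    have h1 := ih (B := V × B) (fun f q => P (Fin.cons q.1 f) q.2) c hc (by
      refine le_trans (le_of_eq ?_) (h.trans (le_of_eq ?_))
      · rw [Fintype.card_prod]; push_cast; ring
      · congr 1
        apply Nat.card_congr
        refine ⟨fun p => ⟨(Fin.tail p.1.1, (p.1.1 0, p.1.2)), ?_⟩,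
          fun p => ⟨(Fin.cons p.1.2.1 p.1.1, p.1.2.2), p.2⟩, ?_, ?_⟩
        · simpa using p.2
        · rintro ⟨⟨a, b⟩, h⟩
          simp
        · rintro ⟨⟨a, b, e⟩, h⟩
          simp)
    have h2 := blow_one (V := V) (B := (Fin m → Fin (t + 1) → V) × B)
      (fun v q => ∀ d : Fin m → Fin (t + 1), P (Fin.cons v (fun i => q.1 i (d i))) q.2)
      (c ^ ((t + 1) ^ m)) (by positivity) t (by
      refine le_trans (le_of_eq ?_) (h1.trans (le_of_eq ?_))
      · simp only [Fintype.card_prod, Fintype.card_pi, Finset.prod_const, Finset.card_univ,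
          Fintype.card_fin]; push_cast; ring
      · congr 1
        apply Nat.card_congr
        exact ⟨fun p => ⟨(p.1.2.1, (p.1.1, p.1.2.2)), p.2⟩,
          fun p => ⟨(p.1.2.1, (p.1.1, p.1.2.2)), p.2⟩, fun p => rfl, fun p => rfl⟩)
    refine le_trans (le_of_eq ?_) (h2.trans (le_of_eq ?_))
    · simp only [Fintype.card_prod, Fintype.card_pi, Finset.prod_const, Finset.card_univ,
          Fintype.card_fin]; push_cast; ring
    · congr 1
      apply Nat.card_congr
      refine ⟨fun p => ⟨(Fin.cons p.1.1 p.1.2.1, p.1.2.2), ?_⟩,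
          fun p => ⟨(p.1.1 0, (Fin.tail p.1.1, p.1.2)), ?_⟩, ?_, ?_⟩
      · intro d
        convert p.2 (d 0) (Fin.tail d) using 1
        funext i
        refine Fin.cases ?_ (fun j => ?_) i <;> simp [Fin.tail]
      · intro k d
        convert p.2 (Fin.cons k d) using 1
        funext i
        refine Fin.cases ?_ (fun j => ?_) i <;> simp [Fin.tail]
      · rintro ⟨⟨a, b⟩, h⟩
        simp
      · rintro ⟨⟨a, b⟩, h⟩
        simp

theorem eq_card {V α : Type*} [Fintype V] [Fintype α] [DecidableEq V] [DecidableEq α]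
    (p q : α) (hpq : p ≠ q) :
    (Finset.univ.filter (fun g : α → V => g p = g q)).card * Fintype.card V ≤
      Fintype.card V ^ Fintype.card α := by
  classical
  rw [← Fintype.card_fun, ← Finset.card_univ (α := V), ← Finset.card_product,
    ← Finset.card_univ (α := α → V)]
  apply Finset.card_le_card_of_injOn (fun x => Function.update x.1 q x.2)
  · intro x _; simp
  · rintro ⟨g, v⟩ hg ⟨g', v'⟩ hg' h
    simp only [Finset.coe_product, Set.mem_prod, Finset.mem_coe, Finset.mem_filter,
      Finset.mem_univ, true_and, and_true] at hg hg' h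
    have hv : v = v' := by simpa using congrFun h q
    have ho : ∀ a, a ≠ q → g a = g' a := by
      intro a ha
      simpa [ha] using congrFun h a
    refine Prod.ext ?_ hv
    funext a
    by_cases ha : a = q
    · subst ha
      change g a = g' a
      rw [← hg, ← hg', ho p hpq]
    · exact ho a ha

theorem noninj_card {V α : Type*} [Fintype V] [Fintype α] [DecidableEq V] [DecidableEq α]
    [DecidablePred (fun g : α → V => ¬ Function.Injective g)] :
    (Finset.univ.filter (fun g : α → V => ¬ Function.Injective g)).card * Fintype.card V ≤
      Fintype.card α ^ 2 * Fintype.card V ^ Fintype.card α := by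
  classical
  have hsub : (Finset.univ.filter (fun g : α → V => ¬ Function.Injective g)) ⊆
      (Finset.univ : Finset α).offDiag.biUnion
        (fun x => Finset.univ.filter (fun g : α → V => g x.1 = g x.2)) := by
    intro g hg
    have hg := (Finset.mem_filter.mp hg).2
    unfold Function.Injective at hg
    push Not at hg
    obtain ⟨a, b, h1, h2⟩ := hg
    simp only [Finset.mem_biUnion, Finset.mem_offDiag, Finset.mem_univ, Finset.mem_filter, true_and]
    exact ⟨(a, b), h2, h1⟩
  calc _ ≤ (∑ x ∈ (Finset.univ : Finset α).offDiag,
        (Finset.univ.filter (fun g : α → V => g x.1 = g x.2)).card) * Fintype.card V :=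
        Nat.mul_le_mul_right _ ((Finset.card_le_card hsub).trans Finset.card_biUnion_le)
    _ = ∑ x ∈ (Finset.univ : Finset α).offDiag,
        (Finset.univ.filter (fun g : α → V => g x.1 = g x.2)).card * Fintype.card V :=
        Finset.sum_mul _ _ _
    _ ≤ ∑ x ∈ (Finset.univ : Finset α).offDiag, Fintype.card V ^ Fintype.card α := by
        apply Finset.sum_le_sum
        rintro ⟨a, b⟩ hx
        simp at hx
        exact eq_card a b hx
    _ ≤ _ := by
        rw [Finset.sum_const, smul_eq_mul]
        apply Nat.mul_le_mul_right
        rw [Finset.offDiag_card, Finset.card_univ, sq]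
        omega

theorem bad_card {V : Type*} [Fintype V] [DecidableEq V] (T : V → V → V → Prop) (p s : ℝ)
    (hs0 : 0 < s) (hs1 : s ≤ 1) (m : ℕ) (hq : 0 ≤ 1 - p * (1 - s ^ 3))
    (hd : ∀ u v, u ≠ v → p * Fintype.card V ≤ {w | T u v w}.ncard)
    (i j : Fin m) (hij : i ≠ j)
    (S : Finset (Fin m → V))
    (hS : ∀ f ∈ S, f i ≠ f j ∧ 3 * {k | T (f i) (f j) (f k)}.ncard ≤ m) :
    S.card * s ^ m ≤ (Fintype.card V : ℝ) ^ m * (1 - p * (1 - s ^ 3)) ^ (m - 2) := by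
  classical
  set q := 1 - p * (1 - s ^ 3) with hqdef
  set n := Fintype.card V with hn
  let w : V → V → V → ℝ := fun u v x => if T u v x then s ^ 3 else 1
  have hw0 : ∀ u v x, 0 ≤ w u v x := by
    intro u v x; simp only [w]; split_ifs <;> positivity
  have hw1 : ∀ u v x, w u v x ≤ 1 := by
    intro u v x; simp only [w]; split_ifs
    · exact pow_le_one₀ hs0.le hs1
    · exact le_rfl
  have step1 : (S.card : ℝ) * s ^ m ≤ ∑ f ∈ S, ∏ k, w (f i) (f j) (f k) := by
    rw [← nsmul_eq_mul]
    apply Finset.card_nsmul_le_sum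
    intro f hf
    have h1 : ∏ k, w (f i) (f j) (f k) = s ^ (3 * {k | T (f i) (f j) (f k)}.ncard) := by
      simp only [w]
      rw [Finset.prod_ite, Finset.prod_const, Finset.prod_const_one, mul_one, ← pow_mul]
      congr 2
      rw [Set.ncard_eq_toFinset_card']
      congr 1
      ext; simp
    rw [h1]
    exact pow_le_pow_of_le_one hs0.le hs1 (hS f hf).2
  let F : V × V → Finset (Fin m → V) := fun x => Fintype.piFinset
    (fun k => if k = i then {x.1} else if k = j then {x.2} else Finset.univ)
  have step2 : ∑ f ∈ S, ∏ k, w (f i) (f j) (f k) ≤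
      ∑ x ∈ (Finset.univ : Finset V).offDiag, ∑ f ∈ F x, ∏ k, w x.1 x.2 (f k) := by
    rw [← Finset.sum_fiberwise_of_maps_to (s := S) (t := (Finset.univ : Finset V).offDiag)
      (g := fun f => (f i, f j)) (by intro f hf; simpa using (hS f hf).1)]
    apply Finset.sum_le_sum
    rintro ⟨u, v⟩ hx
    have : ∑ f ∈ S with (f i, f j) = (u, v), ∏ k, w (f i) (f j) (f k) =
       ∑ f ∈ S with (f i, f j) = (u, v), ∏ k, w u v (f k) := by
      apply Finset.sum_congr rfl
      intro f hf
      simp only [Finset.mem_filter, Prod.mk.injEq] at hf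
      rw [hf.2.1, hf.2.2]
    rw [this]
    apply Finset.sum_le_sum_of_subset_of_nonneg
    · intro f hf
      simp only [Finset.mem_filter, Prod.mk.injEq] at hf
      simp only [F, Fintype.mem_piFinset]
      intro k
      split_ifs with h1 h2
      · subst h1; simp [hf.2.1]
      · subst h2; simp [hf.2.2]
      · simp
    · intro f _ _
      exact Finset.prod_nonneg (fun k _ => hw0 _ _ _)
  have hn0 : (0 : ℝ) ≤ n := by positivity
  have step3 : ∀ x ∈ (Finset.univ : Finset V).offDiag, ∑ f ∈ F x, ∏ k, w x.1 x.2 (f k) ≤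
      ((n : ℝ) * q) ^ (m - 2) := by
    rintro ⟨u, v⟩ hx
    simp only [Finset.mem_offDiag, Finset.mem_univ, true_and] at hx
    simp only [F]
    rw [← Finset.prod_univ_sum]
    have hsum : ∑ x, w u v x ≤ n * q := by
      have h1 : ∑ x, w u v x = n - {y | T u v y}.ncard * (1 - s ^ 3) := by
        have : ∀ x, w u v x = 1 - (if T u v x then 1 else 0) * (1 - s ^ 3) := by
          intro x; simp only [w]; split_ifs <;> ring
        simp_rw [this]
        rw [Finset.sum_sub_distrib, ← Finset.sum_mul, Finset.sum_boole,
          Set.ncard_eq_toFinset_card']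
        simp [hn]
      have h2 := hd u v hx
      have h3 : 0 ≤ 1 - s ^ 3 := by
        have : s ^ 3 ≤ 1 := pow_le_one₀ hs0.le hs1
        linarith
      rw [h1, hqdef]
      nlinarith [mul_le_mul_of_nonneg_right h2 h3]
    calc _ ≤ ∏ k : Fin m, (if k ∈ ({i, j} : Finset (Fin m)) then (1 : ℝ) else n * q) := by
          apply Finset.prod_le_prod
          · intro k _
            exact Finset.sum_nonneg (fun _ _ => hw0 _ _ _)
          · intro k _
            by_cases h1 : k = i
            · simp [h1, hw1]
            · by_cases h2 : k = j
              · simp [h2, hij.symm, hw1]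
              · simpa [h1, h2] using hsum
      _ = _ := by
          rw [Finset.prod_ite, Finset.prod_const_one, one_mul, Finset.prod_const]
          congr 1
          have e : (Finset.univ.filter (fun k => k ∉ ({i, j} : Finset (Fin m)))) =
            ({i, j} : Finset (Fin m))ᶜ := by ext; simp
          rw [e, Finset.card_compl, Finset.card_pair hij, Fintype.card_fin]
  have hm : 2 ≤ m := by
    have := Finset.card_le_univ ({i, j} : Finset (Fin m))
    rw [Finset.card_pair hij] at this
    simpa using this
  calc _ ≤ _ := step1
    _ ≤ _ := step2
    _ ≤ _ := Finset.sum_le_sum step3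
    _ = ((n * n - n : ℕ) : ℝ) * ((n : ℝ) * q) ^ (m - 2) := by
      rw [Finset.sum_const, Finset.offDiag_card, Finset.card_univ, nsmul_eq_mul]
    _ ≤ ((n * n : ℕ) : ℝ) * ((n : ℝ) * q) ^ (m - 2) := by
      apply mul_le_mul_of_nonneg_right _ (by positivity)
      exact_mod_cast Nat.sub_le _ _
    _ = _ := by
      obtain ⟨k, rfl⟩ := Nat.exists_eq_add_of_le hm
      simp only [Nat.add_sub_cancel_left]
      rw [mul_pow, pow_add]
      push_cast
      ring

theorem exists_m (θ s : ℝ) (h0 : 0 ≤ θ) (h1 : θ < 1) (hs : 0 < s) :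
    ∃ m : ℕ, 3 ≤ m ∧ (m : ℝ) ^ 2 * θ ^ (m - 2) ≤ s ^ 2 / 4 := by
  have h := tendsto_pow_const_mul_const_pow_of_abs_lt_one 2 (r := θ) (by rwa [abs_of_nonneg h0])
  have hev := (h.eventually (ge_mem_nhds (show (0 : ℝ) < s ^ 2 / 36 by positivity))).and
    (Filter.eventually_ge_atTop 1)
  obtain ⟨k, hk, hk1⟩ := hev.exists
  refine ⟨k + 2, by omega, ?_⟩
  simp only [Nat.add_sub_cancel]
  have hk1' : (1 : ℝ) ≤ k := by exact_mod_cast hk1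
  have : ((k + 2 : ℕ) : ℝ) ^ 2 ≤ 9 * (k : ℝ) ^ 2 := by push_cast; nlinarith
  calc _ ≤ 9 * (k : ℝ) ^ 2 * θ ^ k := mul_le_mul_of_nonneg_right this (by positivity)
    _ ≤ s ^ 2 / 4 := by linarith

theorem main_upper (ℓ : ℕ) (hℓ : ℓ = 10 ∨ ℓ = 13 ∨ ℓ = 16 ∨ (19 ≤ ℓ ∧ ¬ 3 ∣ ℓ))
    (ε : ℝ) (hε : 0 < ε) (hε3 : ε ≤ 1 / 3) :
    ∃ n0 : ℕ, ∀ (V : Type) [Fintype V], n0 ≤ Fintype.card V → ∀ (T : V → V → V → Prop),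
    (∀ a b c, T a b c → T b a c) → (∀ a b c, T a b c → T b c a) →
    (∀ a b c, T a b c → a ≠ b) →
    (∀ u v, u ≠ v → (1 / 3 + ε) * Fintype.card V ≤ {w | T u v w}.ncard) →
    ∃ φ : ZMod ℓ → V, Function.Injective φ ∧ ∀ j, T (φ j) (φ (j + 1)) (φ (j + 2)) := by
  classical
  set p : ℝ := 1 / 3 + ε with hp
  set s : ℝ := 1 - ε with hs
  set q : ℝ := 1 - p * (1 - s ^ 3) with hq
  have hs0 : 0 < s := by linarith
  have hs1 : s ≤ 1 := by linarith
  have hs3 : 0 < s ^ 3 := by positivity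
  have hs3' : s ^ 3 ≤ 1 := pow_le_one₀ hs0.le hs1
  have hq0 : 0 ≤ q := by nlinarith
  have hqs : q < s := by
    have : s - q = ε * (p * (1 + s + s ^ 2) - 1) := by rw [hq, hs]; ring
    have h2 : 0 < p * (1 + s + s ^ 2) - 1 := by
      rw [hp, hs]; nlinarith [mul_pos hε hε, mul_pos (mul_pos hε hε) hε]
    nlinarith [mul_pos hε h2]
  obtain ⟨m, hm3, hm⟩ := exists_m (q / s) s (by positivity) ((div_lt_one hs0).2 hqs) hs0
  have hℓ2 : 10 ≤ ℓ := by omega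
  obtain ⟨t, rfl⟩ : ∃ t, ℓ = t + 1 := ⟨ℓ - 1, by omega⟩
  have : NeZero (t + 1) := ⟨by omega⟩
  set W : ℕ := Fintype.card (ZMod (t + 1) → Fin m) with hW
  have hWpos : 0 < W := by
    have : Nonempty (Fin m) := ⟨⟨0, by omega⟩⟩
    exact Fintype.card_pos
  have hWr : (0 : ℝ) < W := by exact_mod_cast hWpos
  set c : ℝ := 1 / (2 * W) with hc
  have hc0 : 0 < c := by positivity
  set c' : ℝ := c ^ ((t + 1) ^ m) with hc'
  have hc'0 : 0 < c' := by positivity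
  obtain ⟨n1, hn1⟩ := exists_nat_gt ((((t + 1) * m : ℕ) : ℝ) ^ 2 / c')
  refine ⟨max (4 * m ^ 2) (n1 + 1), ?_⟩
  intro V _ hcard T s1 s2 hne hd
  set n := Fintype.card V with hn
  have hnm : 4 * m ^ 2 ≤ n := le_trans (le_max_left _ _) hcard
  have hnn : n1 + 1 ≤ n := le_trans (le_max_right _ _) hcard
  have hnpos : 0 < n := by omega
  have hnr : (0 : ℝ) < n := by exact_mod_cast hnpos
  -- good maps
  let good : Finset (Fin m → V) := Finset.univ.filter (fun f => Function.Injective f ∧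
    ∀ i j, i ≠ j → m < 3 * {k | T (f i) (f j) (f k)}.ncard)
  let N : Finset (Fin m → V) := Finset.univ.filter (fun f => ¬ Function.Injective f)
  let bad : Fin m × Fin m → Finset (Fin m → V) := fun x => Finset.univ.filter (fun f =>
    f x.1 ≠ f x.2 ∧ 3 * {k | T (f x.1) (f x.2) (f k)}.ncard ≤ m)
  have hcover : (Finset.univ : Finset (Fin m → V)) ⊆
      good ∪ (N ∪ (Finset.univ : Finset (Fin m)).offDiag.biUnion bad) := by
    intro f _
    by_cases h1 : Function.Injective f
    · by_cases h2 : ∀ i j, i ≠ j → m < 3 * {k | T (f i) (f j) (f k)}.ncard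
      · exact Finset.mem_union_left _ (by simp only [good, Finset.mem_filter, Finset.mem_univ, true_and]; exact ⟨h1, h2⟩)
      · push Not at h2
        obtain ⟨i, j, hij, h⟩ := h2
        refine Finset.mem_union_right _ (Finset.mem_union_right _ ?_)
        rw [Finset.mem_biUnion]
        refine ⟨(i, j), by simpa using hij, ?_⟩
        simp only [bad, Finset.mem_filter, Finset.mem_univ, true_and]
        exact ⟨fun h' => hij (h1 h'), h⟩
    · refine Finset.mem_union_right _ (Finset.mem_union_left _ ?_)
      simp only [N, Finset.mem_filter, Finset.mem_univ, true_and]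
      exact h1
  have hcount : n ^ m ≤ good.card + (N.card +
      ∑ x ∈ (Finset.univ : Finset (Fin m)).offDiag, (bad x).card) := by
    have := Finset.card_le_card hcover
    rw [Finset.card_univ, Fintype.card_fun, Fintype.card_fin] at this
    refine this.trans ((Finset.card_union_le _ _).trans (Nat.add_le_add_left ?_ _))
    exact (Finset.card_union_le _ _).trans (Nat.add_le_add_left Finset.card_biUnion_le _)
  have hnm0 : (0 : ℝ) < (n : ℝ) ^ m := by positivity
  have hN : (N.card : ℝ) ≤ (n : ℝ) ^ m / 4 := by
    have h := noninj_card (V := V) (α := Fin m)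
    rw [Fintype.card_fin] at h
    have h' : (N.card : ℝ) * n ≤ (m : ℝ) ^ 2 * (n : ℝ) ^ m := by
      have h2 : N.card * n ≤ m ^ 2 * n ^ m := h
      exact_mod_cast h2
    have h4 : 4 * (m : ℝ) ^ 2 ≤ n := by exact_mod_cast hnm
    have h5 : 4 * (m : ℝ) ^ 2 * (n : ℝ) ^ m ≤ n * (n : ℝ) ^ m :=
      mul_le_mul_of_nonneg_right h4 hnm0.le
    have h6 : (4 * (N.card : ℝ)) * n ≤ (n : ℝ) ^ m * n := by linarith
    have := le_of_mul_le_mul_right h6 hnr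
    linarith
  have hbad : ((∑ x ∈ (Finset.univ : Finset (Fin m)).offDiag, (bad x).card : ℕ) : ℝ)
      ≤ (n : ℝ) ^ m / 4 := by
    have hb : ∀ x ∈ (Finset.univ : Finset (Fin m)).offDiag,
        ((bad x).card : ℝ) ≤ (n : ℝ) ^ m * ((q / s) ^ (m - 2) / s ^ 2) := by
      rintro ⟨i, j⟩ hx
      simp only [Finset.mem_offDiag, Finset.mem_univ, true_and] at hx
      have := bad_card T p s hs0 hs1 m hq0 hd i j hx (bad (i, j)) (by
        intro f hf
        simpa only [bad, Finset.mem_filter, Finset.mem_univ, true_and] using hf)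
      have e : s ^ m = s ^ (m - 2) * s ^ 2 := by rw [← pow_add]; congr 1; omega
      rw [div_pow, div_div, ← e, ← mul_div_assoc, le_div_iff₀ (by positivity)]
      exact this
    push_cast
    refine (Finset.sum_le_sum hb).trans ?_
    rw [Finset.sum_const, nsmul_eq_mul, Finset.offDiag_card, Finset.card_univ, Fintype.card_fin]
    have hmm : ((m * m - m : ℕ) : ℝ) ≤ (m : ℝ) ^ 2 := by
      rw [sq]; exact_mod_cast Nat.sub_le _ _
    calc _ ≤ (m : ℝ) ^ 2 * ((n : ℝ) ^ m * ((q / s) ^ (m - 2) / s ^ 2)) :=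
          mul_le_mul_of_nonneg_right hmm (by positivity)
      _ = (n : ℝ) ^ m * (((m : ℝ) ^ 2 * (q / s) ^ (m - 2)) / s ^ 2) := by ring
      _ ≤ (n : ℝ) ^ m * ((s ^ 2 / 4) / s ^ 2) := by gcongr
      _ = _ := by field_simp
  have hgood : (n : ℝ) ^ m / 2 ≤ good.card := by
    have : (n : ℝ) ^ m ≤ (good.card : ℝ) + (N.card +
      ((∑ x ∈ (Finset.univ : Finset (Fin m)).offDiag, (bad x).card : ℕ) : ℝ)) := by
      exact_mod_cast hcount
    linarith
  -- pigeonhole over walks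
  let G : (ZMod (t + 1) → Fin m) → Finset (Fin m → V) := fun w => Finset.univ.filter
    (fun f => ∀ j, T (f (w j)) (f (w (j + 1))) (f (w (j + 2))))
  have hgG : good ⊆ Finset.univ.biUnion G := by
    intro f hf
    simp only [good, Finset.mem_filter, Finset.mem_univ, true_and] at hf
    obtain ⟨w, hw⟩ := cyc_hom (V := Fin m) (fun i j k => T (f i) (f j) (f k))
      (fun _ _ _ h => s1 _ _ _ h) (fun _ _ _ h => s2 _ _ _ h)
      (fun a b c h hab => hne _ _ _ h (by rw [hab])) (by simpa using hm3)
      (fun u v huv => by simpa using hf.2 u v huv) (t + 1) hℓ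
    simp only [Finset.mem_biUnion, Finset.mem_univ, true_and, G, Finset.mem_filter]
    exact ⟨w, hw⟩
  obtain ⟨w, hw⟩ : ∃ w, c * (n : ℝ) ^ m ≤ (G w).card := by
    by_contra hno
    push Not at hno
    have h1 : (good.card : ℝ) ≤ ∑ w, ((G w).card : ℝ) := by
      exact_mod_cast (Finset.card_le_card hgG).trans Finset.card_biUnion_le
    have : Nonempty (ZMod (t + 1) → Fin m) := Fintype.card_pos_iff.1 hWpos
    have h2 : ∑ w, ((G w).card : ℝ) < ∑ w : ZMod (t + 1) → Fin m, c * (n : ℝ) ^ m :=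
      Finset.sum_lt_sum_of_nonempty Finset.univ_nonempty (fun w _ => hno w)
    rw [Finset.sum_const, Finset.card_univ, ← hW, nsmul_eq_mul] at h2
    have h3 : (W : ℝ) * (c * (n : ℝ) ^ m) = (n : ℝ) ^ m / 2 := by rw [hc]; field_simp
    linarith
  have hblow := blow_up (V := V) t m (B := Unit)
    (fun f _ => ∀ j, T (f (w j)) (f (w (j + 1))) (f (w (j + 2)))) c hc0.le (by
      simp only [Fintype.card_unit, Nat.cast_one, mul_one]
      refine hw.trans (le_of_eq ?_)
      congr 1
      rw [← Fintype.card_coe, ← Nat.card_eq_fintype_card]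
      apply Nat.card_congr
      exact ⟨fun f => ⟨(f.1, ()), (Finset.mem_filter.mp f.2).2⟩,
        fun f => ⟨f.1.1, by simpa [G] using f.2⟩, fun _ => rfl, fun _ => rfl⟩)
  simp only [Fintype.card_unit, Nat.cast_one, mul_one] at hblow
  let K : Finset (Fin m × Fin (t + 1) → V) := Finset.univ.filter (fun g =>
    ∀ d : Fin m → Fin (t + 1), ∀ j, T (g (w j, d (w j))) (g (w (j + 1), d (w (j + 1))))
      (g (w (j + 2), d (w (j + 2)))))
  have hK : c' * (n : ℝ) ^ ((t + 1) * m) ≤ K.card := by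
    refine hblow.trans (le_of_eq ?_)
    congr 1
    rw [← Fintype.card_coe, ← Nat.card_eq_fintype_card]
    apply Nat.card_congr
    exact ⟨fun g => ⟨fun x => g.1.1 x.1 x.2, by simpa [K] using g.2⟩,
      fun g => ⟨(fun a b => g.1 (a, b), ()), (Finset.mem_filter.mp g.2).2⟩, fun _ => rfl, fun _ => rfl⟩
  obtain ⟨g, hgK, hginj⟩ : ∃ g ∈ K, Function.Injective g := by
    by_contra hno
    push Not at hno
    have hsub : K ⊆ Finset.univ.filter (fun g => ¬ Function.Injective g) := by
      intro g hg
      rw [Finset.mem_filter]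
      exact ⟨Finset.mem_univ _, hno g hg⟩
    have h1 := noninj_card (V := V) (α := Fin m × Fin (t + 1))
    have h2 : K.card * n ≤ ((t + 1) * m) ^ 2 * n ^ ((t + 1) * m) := by
      refine (Nat.mul_le_mul_right _ (Finset.card_le_card hsub)).trans (h1.trans (le_of_eq ?_))
      rw [Fintype.card_prod, Fintype.card_fin, Fintype.card_fin, mul_comm m]
    have h2' : (K.card : ℝ) * n ≤ (((t + 1) * m : ℕ) : ℝ) ^ 2 * (n : ℝ) ^ ((t + 1) * m) := by
      exact_mod_cast h2
    have h3 : (n1 : ℝ) < n := by exact_mod_cast (by omega : n1 < n)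
    have h4 := (div_lt_iff₀ hc'0).1 (hn1.trans h3)
    have h5 : (0 : ℝ) < (n : ℝ) ^ ((t + 1) * m) := by positivity
    have h6 := mul_lt_mul_of_pos_right h4 h5
    have h7 := mul_le_mul_of_nonneg_right hK hnr.le
    nlinarith
  simp only [K, Finset.mem_filter, Finset.mem_univ, true_and] at hgK
  have hwne : ∀ j, w j ≠ w (j + 1) ∧ w (j + 1) ≠ w (j + 2) ∧ w j ≠ w (j + 2) := by
    intro j
    have h := hgK (fun _ => 0) j
    refine ⟨fun e => hne _ _ _ h (by rw [e]), fun e => hne _ _ _ (s2 _ _ _ h) (by rw [e]),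
      fun e => hne _ _ _ (s2 _ _ _ (s2 _ _ _ h)) (by rw [e])⟩
  let e : ZMod (t + 1) ≃ Fin (t + 1) := Fintype.equivFinOfCardEq (ZMod.card _)
  refine ⟨fun j => g (w j, e j), fun a b hab => ?_, fun j => ?_⟩
  · have := hginj hab
    simp only [Prod.mk.injEq] at this
    exact e.injective this.2
  · have h := hgK (fun i => if i = w j then e j else if i = w (j + 1) then e (j + 1) else e (j + 2)) j
    obtain ⟨a1, a2, a3⟩ := hwne j
    simpa [a1.symm, a2.symm, a3.symm] using h

theorem ex2_set_bdd {α : Type*} [DecidableEq α] (n : ℕ) (hn : 2 ≤ n) (F : Set (Finset α)) :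
    BddAbove {d | ∃ E : Set (Finset (Fin n)),
    (∀ e ∈ E, e.card = 3) ∧
    (¬ ∃ φ : α → Fin n, Function.Injective φ ∧ ∀ e ∈ F, e.image φ ∈ E) ∧
    (∀ u v : Fin n, u ≠ v →
      d ≤ ({w | ({u, v, w} : Finset (Fin n)) ∈ E} : Set (Fin n)).ncard)} := by
  refine ⟨n, ?_⟩
  rintro d ⟨E, -, -, h⟩
  refine (h ⟨0, by omega⟩ ⟨1, by omega⟩ (by simp)).trans ?_
  refine (Set.ncard_le_card _).trans ?_
  simp

theorem upper (ℓ : ℕ) (hℓ : ℓ = 10 ∨ ℓ = 13 ∨ ℓ = 16 ∨ (19 ≤ ℓ ∧ ¬ 3 ∣ ℓ)) (ε : ℝ) (hε : 0 < ε)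
    (hε3 : ε ≤ 1 / 3) :
    ∃ n0 : ℕ, ∀ n ≥ n0, (ex2 n (CycleEdges ℓ) : ℝ) < (1 / 3 + ε) * n := by
  classical
  obtain ⟨n0, h0⟩ := main_upper ℓ hℓ ε hε hε3
  refine ⟨max n0 2, fun n hn => ?_⟩
  have hn0 : n0 ≤ n := (le_max_left _ _).trans hn
  have hn2 : 2 ≤ n := (le_max_right _ _).trans hn
  have hmem := Nat.sSup_mem (s := {d | ∃ E : Set (Finset (Fin n)),
    (∀ e ∈ E, e.card = 3) ∧
    (¬ ∃ φ : ZMod ℓ → Fin n, Function.Injective φ ∧ ∀ e ∈ CycleEdges ℓ, e.image φ ∈ E) ∧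
    (∀ u v : Fin n, u ≠ v →
      d ≤ ({w | ({u, v, w} : Finset (Fin n)) ∈ E} : Set (Fin n)).ncard)}) (by
      refine ⟨0, ∅, by simp, ?_, by simp⟩
      rintro ⟨φ, -, h⟩
      exact h _ ⟨0, rfl⟩) (ex2_set_bdd n hn2 _)
  obtain ⟨E, hE3, hEF, hEd⟩ := hmem
  by_contra hcon
  push Not at hcon
  apply hEF
  have hne : ∀ a b c : Fin n, ({a, b, c} : Finset (Fin n)) ∈ E → a ≠ b := by
    rintro a b c h rfl
    have := hE3 _ h
    have h2 : ({a, a, c} : Finset (Fin n)).card ≤ 2 := by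
      rw [Finset.insert_eq_of_mem (by simp)]; exact Finset.card_le_two
    omega
  obtain ⟨φ, hinj, hφ⟩ := h0 (Fin n) (by simpa using hn0)
    (fun a b c => ({a, b, c} : Finset (Fin n)) ∈ E)
    (fun a b c h => by rwa [Finset.insert_comm])
    (fun a b c h => by
      have : ({b, c, a} : Finset (Fin n)) = {a, b, c} := by ext; simp; tauto
      rwa [this]) hne
    (fun u v huv => by
      rw [Fintype.card_fin]
      refine hcon.trans ?_
      exact_mod_cast hEd u v huv)
  refine ⟨φ, hinj, ?_⟩
  rintro e ⟨j, rfl⟩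
  simpa [Finset.image_insert] using hφ j

theorem lower (ℓ : ℕ) (hℓ : ¬ 3 ∣ ℓ) (k : ℕ) (hk : 1 ≤ k) :
    k ≤ ex2 (3 * k) (CycleEdges ℓ) + 2 := by
  classical
  rw [← Nat.sub_le_iff_le_add]
  refine le_csSup (ex2_set_bdd (3 * k) (by omega) _) ?_
  refine ⟨{e | e.card = 3 ∧ ∑ v ∈ e, ((v : ℕ) : ZMod 3) = 1}, fun e he => he.1, ?_, ?_⟩
  · rintro ⟨φ, hinj, h⟩
    have hsum : ∀ j, ((φ j : ℕ) : ZMod 3) + ((φ (j + 1) : ℕ) : ZMod 3) +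
        ((φ (j + 2) : ℕ) : ZMod 3) = 1 := by
      intro j
      obtain ⟨h1, h2⟩ := h _ ⟨j, rfl⟩
      rw [Finset.card_image_of_injective _ hinj] at h1
      rw [Finset.sum_image (fun _ _ _ _ h => hinj h)] at h2
      have d1 : j ∉ ({j + 1, j + 2} : Finset (ZMod ℓ)) := by
        intro hj
        rw [Finset.insert_eq_of_mem hj] at h1
        have := Finset.card_le_two (a := j + 1) (b := j + 2)
        omega
      have d2 : j + 1 ∉ ({j + 2} : Finset (ZMod ℓ)) := by
        intro hj
        rw [Finset.insert_eq_of_mem hj] at h1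
        have := Finset.card_le_two (a := j) (b := j + 2)
        omega
      rw [Finset.sum_insert d1, Finset.sum_insert d2, Finset.sum_singleton] at h2
      rw [← h2]; ring
    have hper : ∀ j, ((φ (j + 3) : ℕ) : ZMod 3) = ((φ j : ℕ) : ZMod 3) := by
      intro j
      have h1 := hsum j
      have h2 := hsum (j + 1)
      rw [show j + 1 + 1 = j + 2 by ring, show j + 1 + 2 = j + 3 by ring] at h2
      linear_combination h2 - h1
    have hper' : ∀ r : ℕ, ∀ j, ((φ (j + 3 * r) : ℕ) : ZMod 3) = ((φ j : ℕ) : ZMod 3) := by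
      intro r
      induction r with
      | zero => intro j; simp
      | succ r ih =>
        intro j
        rw [← ih j, ← hper (j + 3 * r)]
        congr 3
        push_cast
        ring
    have hcop : Nat.Coprime 3 ℓ := (Nat.Prime.coprime_iff_not_dvd Nat.prime_three).2 hℓ
    have hstep : ∀ j, ((φ (j + 1) : ℕ) : ZMod 3) = ((φ j : ℕ) : ZMod 3) := by
      intro j
      have hz : ℓ ≠ 0 := by rintro rfl; simp at hℓ
      have : NeZero ℓ := ⟨hz⟩
      have hi : (3 : ZMod ℓ) * (((3 : ZMod ℓ)⁻¹).val : ℕ) = 1 := by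
        rw [ZMod.natCast_zmod_val]
        have := ZMod.coe_mul_inv_eq_one 3 hcop
        simpa using this
      rw [← hper' ((3 : ZMod ℓ)⁻¹).val j, hi]
    have h0 := hsum 0
    rw [show (0 : ZMod ℓ) + 2 = 0 + 1 + 1 by ring, hstep (0 + 1), hstep 0] at h0
    have h30 : (3 : ZMod 3) = 0 := by decide
    have : (3 : ZMod 3) * ((φ 0 : ℕ) : ZMod 3) = 1 := by rw [← h0]; ring
    rw [h30, zero_mul] at this
    exact absurd this (by decide)
  · intro u v huv
    set a : ZMod 3 := 1 - (u : ℕ) - (v : ℕ) with ha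
    have hsub : ((Set.range (fun i : Fin k => (⟨a.val + 3 * i, by
        have := ZMod.val_lt a; omega⟩ : Fin (3 * k)))) \ {u, v}) ⊆
        {w | ({u, v, w} : Finset (Fin (3 * k))) ∈
          {e : Finset (Fin (3 * k)) | e.card = 3 ∧ ∑ v ∈ e, ((v : ℕ) : ZMod 3) = 1}} := by
      rintro w ⟨⟨i, hi⟩, hw⟩
      simp only [Set.mem_insert_iff, Set.mem_singleton_iff, not_or] at hw
      have d1 : u ∉ ({v, w} : Finset (Fin (3 * k))) := by
        simp [huv, Ne.symm hw.1]
      have d2 : v ∉ ({w} : Finset (Fin (3 * k))) := by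
        simp [Ne.symm hw.2]
      refine ⟨?_, ?_⟩
      · rw [Finset.card_insert_of_notMem d1, Finset.card_insert_of_notMem d2,
          Finset.card_singleton]
      · rw [Finset.sum_insert d1, Finset.sum_insert d2, Finset.sum_singleton, ← hi]
        have h30 : (3 : ZMod 3) = 0 := by decide
        push_cast
        rw [ZMod.natCast_zmod_val, h30, ha]
        ring
    have h1 := Set.ncard_le_ncard hsub
    have h2 : (Set.range (fun i : Fin k => (⟨a.val + 3 * i, by
        have := ZMod.val_lt a; omega⟩ : Fin (3 * k)))).ncard = k := by
      rw [← Set.image_univ, Set.ncard_image_of_injective]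
      · simp [Set.ncard_univ]
      · intro x y hxy
        simp only [Fin.mk.injEq] at hxy
        ext; omega
    have h3 := Set.le_ncard_sdiff ({u, v} : Set (Fin (3 * k))) (Set.range (fun i : Fin k => (⟨a.val + 3 * i, by
        have := ZMod.val_lt a; omega⟩ : Fin (3 * k))))
    have h4 : ({u, v} : Set (Fin (3 * k))).ncard ≤ 2 := Set.ncard_insert_le _ _ |>.trans (by simp)
    omega

/-- For `ℓ ∈ {10, 13, 16}` and for every `ℓ ≥ 19` not divisible by 3, the
codegree Turán density of the tight cycle `C_ℓ` equals `1/3`: the limit of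
`ex₂(n, C_ℓ)/n` is `1/3`. -/
theorem stmt19 (ℓ : ℕ)
    (hℓ : ℓ = 10 ∨ ℓ = 13 ∨ ℓ = 16 ∨ (19 ≤ ℓ ∧ ¬ 3 ∣ ℓ)) (g : ℝ)
    (hg : Tendsto (fun n => (ex2 n (CycleEdges ℓ) : ℝ) / n) atTop (nhds g)) :
    g = 1 / 3 := by
  apply le_antisymm
  · apply le_of_forall_pos_le_add
    intro ε hε
    obtain ⟨n0, h0⟩ := upper ℓ hℓ (min ε (1 / 3)) (lt_min hε (by norm_num)) (min_le_right _ _)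
    refine le_of_tendsto hg ?_
    filter_upwards [eventually_ge_atTop n0, eventually_gt_atTop 0] with n hn hn0
    have hnr : (0 : ℝ) < n := by exact_mod_cast hn0
    rw [div_le_iff₀ hnr]
    refine (h0 n hn).le.trans (mul_le_mul_of_nonneg_right ?_ hnr.le)
    linarith [min_le_left ε (1 / 3)]
  · have h3 : ¬ 3 ∣ ℓ := by omega
    have htend : Tendsto (fun k : ℕ => 3 * k) atTop atTop :=
      tendsto_id.const_mul_atTop' (by norm_num)
    have h1 := hg.comp htend
    have h2 : Tendsto (fun k : ℕ => (1 / 3 : ℝ) - (2 / 3) / k) atTop (nhds (1 / 3 - 0)) :=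
      tendsto_const_nhds.sub (tendsto_const_div_atTop_nhds_zero_nat _)
    rw [sub_zero] at h2
    refine le_of_tendsto_of_tendsto h2 h1 ?_
    filter_upwards [eventually_ge_atTop 1] with k hk
    have hkr : (0 : ℝ) < k := by exact_mod_cast hk
    have h := lower ℓ h3 k hk
    have h' : (k : ℝ) ≤ ex2 (3 * k) (CycleEdges ℓ) + 2 := by exact_mod_cast h
    simp only [Function.comp]
    push_cast
    rw [le_div_iff₀ (by positivity)]
    have : (1 / 3 - 2 / 3 / (k : ℝ)) * (3 * k) = k - 2 := by field_simp
    linarith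
end
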